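/- arXiv:1605.05755 — 3 statements merged into one kernel-verified Lean document; each statement's English description precedes it below -/
import Mathlib

section
/- Fix α ∈ ℝ with α ≠ 0, and for t ∈ ℝ let φ^t : ℝ³ → ℝ³ be the linear map given by the diagonal matrix diag(e^{2(α+1)t/α}, e^{t}, e^{−2t/α}). Then for every t ∈ ℝ, every x ∈ ℝ³ with x₃ > 0 and all u, w ∈ ℝ³: the third coordinate of φ^t x equals e^{−2t/α}·x₃ and is positive, and ((φ^t x)₃)^α · g₀(φ^t u, φ^t w) = x₃^α · g₀(u, w). In other words, each φ^t is a linear isometry of the Lorentz metric g_α on the half-space {x₃ > 0}. -/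
/-- The Minkowski bilinear form `g₀(u,w) = −u₁w₃ − u₃w₁ + u₂w₂` on `ℝ³`
(the flat Lorentz metric `−2dx₁dx₃ + dx₂²`). -/
def g₀ (u w : Fin 3 → ℝ) : ℝ := -(u 0 * w 2) - u 2 * w 0 + u 1 * w 1

/-- The linear flow `φ^t = diag(e^{2(α+1)t/α}, e^{t}, e^{−2t/α})` on `ℝ³`. -/
noncomputable def φ (α t : ℝ) (x : Fin 3 → ℝ) : Fin 3 → ℝ :=
  ![Real.exp (2 * (α + 1) * t / α) * x 0, Real.exp t * x 1, Real.exp (-2 * t / α) * x 2]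

/-- each `φ^t` preserves the half-space `{x₃ > 0}` (the third coordinate of
`φ^t x` is `e^{−2t/α}·x₃ > 0`) and is a linear isometry of the Lorentz metric
`g_α(x)(u,w) = x₃^α·g₀(u,w)` there. -/
theorem phi_isometry_of_g_alpha (α : ℝ) (hα : α ≠ 0) (t : ℝ) (x : Fin 3 → ℝ)
    (hx : 0 < x 2) (u w : Fin 3 → ℝ) :
    φ α t x 2 = Real.exp (-2 * t / α) * x 2 ∧ 0 < φ α t x 2 ∧
      (φ α t x 2) ^ α * g₀ (φ α t u) (φ α t w) = (x 2) ^ α * g₀ u w := by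
  have h2 : φ α t x 2 = Real.exp (-2 * t / α) * x 2 := rfl
  refine ⟨h2, h2 ▸ mul_pos (Real.exp_pos _) hx, ?_⟩
  have hscale : Real.exp (-2 * t / α) ^ α = Real.exp (-2 * t) := by
    rw [← Real.exp_mul, div_mul_cancel₀ _ hα]
  have hnull : Real.exp (-2 * t) *
      (Real.exp (2 * (α + 1) * t / α) * Real.exp (-2 * t / α)) = 1 := by
    rw [← Real.exp_add, ← Real.exp_add, Real.exp_eq_one_iff]
    field_simp
    ring
  have hspace : Real.exp (-2 * t) * (Real.exp t * Real.exp t) = 1 := by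
    rw [← Real.exp_add, ← Real.exp_add, Real.exp_eq_one_iff]
    ring
  rw [h2, Real.mul_rpow (Real.exp_pos _).le hx.le, hscale]
  simp only [g₀, φ, Matrix.cons_val]
  linear_combination (x 2 ^ α * (-(u 0 * w 2) - u 2 * w 0)) * hnull +
    (x 2 ^ α * (u 1 * w 1)) * hspace
end

section
/- Fix α ∈ ℝ with α ≠ 0. For every pair of points x, y ∈ ℝ³ with x₃ > 0 and y₃ > 0, there exist an invertible linear map L : ℝ³ → ℝ³ and a vector b ∈ ℝ³ such that: L x + b = y; for every p ∈ ℝ³ with p₃ > 0 one has (L p + b)₃ > 0; and for every p with p₃ > 0 and all u, w ∈ ℝ³, ((L p + b)₃)^α · g₀(L u, L w) = p₃^α · g₀(u, w). In other words, the group of affine isometries of the Lorentz metric g_α acts transitively on the half-space {x₃ > 0}, so g_α is a homogeneous metric. -/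
/-- The invertible diagonal map of `ι → ℝ` with nonzero diagonal entries `d`. -/
noncomputable def diagonalEquiv {ι : Type*} (d : ι → ℝ) (hd : ∀ i, d i ≠ 0) :
    (ι → ℝ) ≃ₗ[ℝ] (ι → ℝ) :=
  LinearEquiv.piCongrRight fun i => LinearEquiv.smulOfNeZero ℝ ℝ (d i) (hd i)

theorem diagonalEquiv_apply {ι : Type*} (d : ι → ℝ) (hd : ∀ i, d i ≠ 0) (p : ι → ℝ) (i : ι) :
    diagonalEquiv d hd p i = d i * p i :=
  rfl


/-- the affine isometry group of the Lorentz metric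
`g_α(x)(u,w) = x₃^α·g₀(u,w)` acts transitively on the half-space `{x₃ > 0}`:
for any two points `x, y` of the half-space there is an affine map `p ↦ L p + b`
with invertible linear part sending `x` to `y`, preserving the half-space, and
pulling `g_α` back to itself. -/
theorem g_alpha_homogeneous (α : ℝ) (hα : α ≠ 0) (x y : Fin 3 → ℝ)
    (hx : 0 < x 2) (hy : 0 < y 2) :
    ∃ (L : (Fin 3 → ℝ) ≃ₗ[ℝ] (Fin 3 → ℝ)) (b : Fin 3 → ℝ),
      L x + b = y ∧
      (∀ p : Fin 3 → ℝ, 0 < p 2 → 0 < (L p + b) 2) ∧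
      (∀ p : Fin 3 → ℝ, 0 < p 2 → ∀ u w : Fin 3 → ℝ,
        ((L p + b) 2) ^ α * g₀ (L u) (L w) = (p 2) ^ α * g₀ u w) := by
  obtain ⟨t, ht, hty⟩ : ∃ t : ℝ, 0 < t ∧ t * x 2 = y 2 :=
    ⟨y 2 / x 2, div_pos hy hx, div_mul_cancel₀ _ hx.ne'⟩
  obtain ⟨s, hs, hst⟩ : ∃ s : ℝ, 0 < s ∧ t ^ α = s * s :=
    ⟨t ^ (α / 2), Real.rpow_pos_of_pos ht _, by rw [← Real.rpow_add ht, add_halves]⟩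
  have hd : ∀ i, (![(s * s * t)⁻¹, s⁻¹, t] : Fin 3 → ℝ) i ≠ 0 := by
    intro i
    fin_cases i <;> simp [hs.ne', ht.ne']
  let L := diagonalEquiv ![(s * s * t)⁻¹, s⁻¹, t] hd
  have hb : ∀ p : Fin 3 → ℝ, (L p + (y - L x)) 2 = t * p 2 := by
    intro p
    simp [L, diagonalEquiv_apply, hty]
  refine ⟨L, y - L x, by simp, fun p hp => ?_, fun p hp u w => ?_⟩
  · rw [hb]
    exact mul_pos ht hp
  · rw [hb, Real.mul_rpow ht.le hp.le, hst]
    simp only [g₀, L, diagonalEquiv_apply, Matrix.cons_val]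
    field_simp
end

section
/- Let α₁ ∈ ℝ, let z > 1, and set α₂ = α₁·(z − 1)/z (equivalently α₁/z = α₂/(z − 1)). Define f : (1, ∞) → ℝ by f(s) = s^{α₁} for 1 < s ≤ z and f(s) = z^{α₁}·(z − 1)^{−α₂}·(s − 1)^{α₂} for s > z. Then f is continuously differentiable on (1, ∞): the two pieces and their first derivatives agree at s = z, namely f is continuous at z with f(z) = z^{α₁}, and f is differentiable at z with derivative α₁·z^{α₁−1}. -/
/-- Two functions with continuous derivatives on an open set `U` that agree to first order at `z`
glue along `z` to a `C¹` function on `U`. -/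
theorem contDiffOn_one_of_glue {U : Set ℝ} (hU : IsOpen U) {z : ℝ} (hz : z ∈ U)
    {f a b a' b' : ℝ → ℝ}
    (ha : ∀ s ∈ U, HasDerivAt a (a' s) s) (hb : ∀ s ∈ U, HasDerivAt b (b' s) s)
    (ha' : ContinuousOn a' U) (hb' : ContinuousOn b' U)
    (hab : a z = b z) (hab' : a' z = b' z)
    (hfa : ∀ s ∈ U, s ≤ z → f s = a s) (hfb : ∀ s ∈ U, z < s → f s = b s) :
    ContDiffOn ℝ 1 f U ∧ HasDerivAt f (a' z) z := by
  have hfz : f z = a z := hfa z hz le_rfl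
  have hfb₀ : ∀ s ∈ U, z ≤ s → f s = b s := fun s hs h ↦ by
    rcases h.eq_or_lt with rfl | h
    · exact hfz.trans hab
    · exact hfb s hs h
  have hd : HasDerivAt f (a' z) z := by
    have h₁ : HasDerivWithinAt f (a' z) (Set.Iic z) z := by
      refine (ha z hz).hasDerivWithinAt.congr_of_eventuallyEq ?_ hfz
      filter_upwards [self_mem_nhdsWithin, nhdsWithin_le_nhds (hU.mem_nhds hz)] with s h hs
      exact hfa s hs h
    have h₂ : HasDerivWithinAt f (a' z) (Set.Ici z) z := by
      rw [hab']
      refine (hb z hz).hasDerivWithinAt.congr_of_eventuallyEq ?_ (hfz.trans hab)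
      filter_upwards [self_mem_nhdsWithin, nhdsWithin_le_nhds (hU.mem_nhds hz)] with s h hs
      exact hfb₀ s hs h
    simpa [Set.Iic_union_Ici] using h₁.union h₂
  have hderiv : ∀ s ∈ U, HasDerivAt f (if s ≤ z then a' s else b' s) s := by
    intro s hs
    rcases lt_trichotomy s z with h | rfl | h
    · rw [if_pos h.le]
      refine (ha s hs).congr_of_eventuallyEq ?_
      filter_upwards [Iio_mem_nhds h, hU.mem_nhds hs] with t ht htU
      exact hfa t htU (le_of_lt ht)
    · simpa using hd
    · rw [if_neg h.not_ge]
      refine (hb s hs).congr_of_eventuallyEq ?_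
      filter_upwards [Ioi_mem_nhds h, hU.mem_nhds hs] with t ht htU
      exact hfb t htU ht
  refine ⟨?_, hd⟩
  have hcont : ContinuousOn (fun s ↦ if s ≤ z then a' s else b' s) U := by
    refine ContinuousOn.if (fun s hs ↦ ?_) (ha'.mono Set.inter_subset_left)
      (hb'.mono Set.inter_subset_left)
    have hsz : s = z := frontier_le_subset_eq continuous_id continuous_const hs.2
    rw [hsz, hab']
  rw [← zero_add (1 : WithTop ℕ∞), contDiffOn_succ_iff_deriv_of_isOpen hU]
  refine ⟨fun s hs ↦ (hderiv s hs).differentiableAt.differentiableWithinAt, by simp, ?_⟩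
  rw [contDiffOn_zero]
  exact hcont.congr fun s hs ↦ (hderiv s hs).deriv

/-- gluing the conformal factors `s^{α₁}` (for `1 < s ≤ z`) and
`z^{α₁}·(z−1)^{−α₂}·(s−1)^{α₂}` (for `s > z`), with `α₂ = α₁·(z−1)/z`, yields a
`C¹` function on `(1, ∞)`; in particular the glued function is continuous at `z`
with value `z^{α₁}` and differentiable at `z` with derivative `α₁·z^{α₁−1}`. -/
theorem glued_conformal_factor_C1 (α₁ z : ℝ) (hz : 1 < z) (α₂ : ℝ)
    (hα₂ : α₂ = α₁ * (z - 1) / z)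
    (f : ℝ → ℝ)
    (hf : ∀ s : ℝ, 1 < s →
      (s ≤ z → f s = s ^ α₁) ∧
      (z < s → f s = z ^ α₁ * (z - 1) ^ (-α₂) * (s - 1) ^ α₂)) :
    ContDiffOn ℝ 1 f (Set.Ioi 1) ∧ f z = z ^ α₁ ∧
      HasDerivAt f (α₁ * z ^ (α₁ - 1)) z := by
  have hz₀ : 0 < z := by linarith
  have hz₁ : 0 < z - 1 := by linarith
  obtain ⟨hC, hD⟩ := contDiffOn_one_of_glue (f := f) (U := Set.Ioi 1) isOpen_Ioi hz
    (a := fun s ↦ s ^ α₁) (a' := fun s ↦ α₁ * s ^ (α₁ - 1))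
    (b := fun s ↦ z ^ α₁ * (z - 1) ^ (-α₂) * (s - 1) ^ α₂)
    (b' := fun s ↦ z ^ α₁ * (z - 1) ^ (-α₂) * (α₂ * (s - 1) ^ (α₂ - 1)))
    (fun s hs ↦ Real.hasDerivAt_rpow_const (.inl (zero_lt_one.trans hs).ne'))
    (fun s hs ↦ by
      have h := ((hasDerivAt_id s).sub_const 1).rpow_const (p := α₂)
        (.inl (sub_pos.2 hs).ne')
      simpa using h.const_mul (z ^ α₁ * (z - 1) ^ (-α₂)))
    (continuousOn_const.mul <| continuousOn_id.rpow_const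
      fun s hs ↦ .inl (zero_lt_one.trans hs).ne')
    (continuousOn_const.mul <| continuousOn_const.mul <|
      (continuousOn_id.sub continuousOn_const).rpow_const fun s hs ↦ .inl (sub_pos.2 hs).ne')
    (by
      have := (Real.rpow_pos_of_pos hz₁ α₂).ne'
      simp only [Real.rpow_neg hz₁.le]
      field_simp)
    (by
      have := (Real.rpow_pos_of_pos hz₁ α₂).ne'
      simp only [Real.rpow_neg hz₁.le, Real.rpow_sub_one hz₁.ne', Real.rpow_sub_one hz₀.ne']
      have hα : α₂ / (z - 1) = α₁ / z := by rw [hα₂]; field_simp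
      calc α₁ * (z ^ α₁ / z) = z ^ α₁ * (α₁ / z) := by ring
        _ = z ^ α₁ * (α₂ / (z - 1)) := by rw [hα]
        _ = _ := by field_simp)
    (fun s hs ↦ (hf s hs).1) (fun s hs ↦ (hf s hs).2)
  exact ⟨hC, (hf z hz).1 le_rfl, hD⟩
end
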